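/- arXiv:1611.04034 — 2 statements merged into one kernel-verified Lean document; each statement's English description precedes it below -/
import Mathlib

section
/- In any public decision making instance, every maximum Nash welfare (MNW) outcome c satisfies (1/n)-RRS, i.e., u_i(c) ≥ (1/n)·RRS_i for every player i; consequently it also satisfies (1/n)-PPS, i.e., u_i(c) ≥ (1/n)·PPS_i for every player i. -/
open Finset

structure PubInst (n m : ℕ) where
  A : Fin m → Type
  fin : ∀ t, Fintype (A t)
  nonempty : ∀ t, Nonempty (A t)
  u : Fin n → (t : Fin m) → A t → ℝ
  nonneg : ∀ i t a, 0 ≤ u i t a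

namespace PubInst

variable {n m : ℕ}

/-- An outcome chooses one alternative per issue. -/
def Outcome (I : PubInst n m) : Type := (t : Fin m) → I.A t

/-- Utility of player `i` under outcome `c`. -/
noncomputable def util (I : PubInst n m) (c : I.Outcome) (i : Fin n) : ℝ :=
  ∑ t : Fin m, I.u i t (c t)

/-- Maximum utility player `i` can derive from issue `t`. -/
noncomputable def umax (I : PubInst n m) (i : Fin n) (t : Fin m) : ℝ :=
  letI := I.fin t
  Finset.univ.sup' (Finset.univ_nonempty_iff.mpr (I.nonempty t)) (I.u i t)

/-- Values of `f` sorted in non-increasing order: `sortedDesc f r` is the `(r+1)`-th largest. -/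
noncomputable def sortedDesc (f : Fin m → ℝ) : Fin m → ℝ :=
  fun r => f (Tuple.sort (fun j => -f j) r)

noncomputable def propShare (I : PubInst n m) (i : Fin n) : ℝ :=
  (1 / (n : ℝ)) * ∑ t : Fin m, I.umax i t

noncomputable def RRS (I : PubInst n m) (i : Fin n) : ℝ :=
  ∑ r : Fin m,
    if n ∣ (r.val + 1) ∧ r.val + 1 ≤ (m / n) * n then sortedDesc (I.umax i) r else 0

noncomputable def PPS (I : PubInst n m) (i : Fin n) : ℝ :=
  ∑ r : Fin m, if m - m / n ≤ r.val then sortedDesc (I.umax i) r else 0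

def ParetoOptimal (I : PubInst n m) (c : I.Outcome) : Prop :=
  ¬ ∃ c' : I.Outcome, (∀ i, I.util c i ≤ I.util c' i) ∧ ∃ j, I.util c j < I.util c' j

def MNW (I : PubInst n m) (c : I.Outcome) : Prop :=
  (∀ c' : I.Outcome,
      (Finset.univ.filter fun i => 0 < I.util c' i).card ≤
        (Finset.univ.filter fun i => 0 < I.util c i).card) ∧
  (∀ c' : I.Outcome,
      (∏ i ∈ Finset.univ.filter fun i => 0 < I.util c i, I.util c' i) ≤
        ∏ i ∈ Finset.univ.filter fun i => 0 < I.util c i, I.util c i)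

end PubInst

namespace PubInst

variable {n m : ℕ}

theorem util_nonneg (I : PubInst n m) (c : I.Outcome) (i : Fin n) : 0 ≤ I.util c i :=
  Finset.sum_nonneg fun t _ => I.nonneg i t (c t)

theorem exists_eq_umax (I : PubInst n m) (i : Fin n) (t : Fin m) :
    ∃ a, I.u i t a = I.umax i t := by
  let := I.fin t
  obtain ⟨a, -, h⟩ := Finset.exists_mem_eq_sup'
    (Finset.univ_nonempty_iff.mpr (I.nonempty t)) (I.u i t)
  exact ⟨a, h.symm⟩

theorem umax_nonneg (I : PubInst n m) (i : Fin n) (t : Fin m) : 0 ≤ I.umax i t := by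
  obtain ⟨a, ha⟩ := I.exists_eq_umax i t
  exact ha ▸ I.nonneg i t a

theorem sortedDesc_antitone (f : Fin m → ℝ) : Antitone (sortedDesc f) := by
  intro a b hab
  have h := Tuple.monotone_sort (fun j => -f j) hab
  simpa [sortedDesc] using h

theorem sum_ite_eq_sum_of_range {ι κ : Type*} [Fintype ι] [Fintype κ] (F : κ → ℝ)
    (P : κ → Prop) [DecidablePred P] (g : ι → κ) (hg : Function.Injective g)
    (hP : ∀ r, P r ↔ ∃ k, g k = r) :
    ∑ r, (if P r then F r else 0) = ∑ k, F (g k) := by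
  classical
  rw [← Finset.sum_filter, ← Finset.sum_image (s := univ) (f := F) hg.injOn]
  congr 1
  ext r
  simp [hP]

/-- The `l`-th position of the `k`-th block of `n` consecutive positions. -/
def blockIdx (n m : ℕ) (x : Fin (m / n) × Fin n) : Fin m :=
  Fin.castLE (Nat.div_mul_le_self m n) (finProdFinEquiv x)

theorem blockIdx_val (x : Fin (m / n) × Fin n) :
    (blockIdx n m x).val = x.2.val + n * x.1.val := by
  simp [blockIdx]

theorem blockIdx_injective : Function.Injective (blockIdx n m) :=
  (Fin.castLE_injective _).comp finProdFinEquiv.injective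

/-- The last position of a block. -/
def blockLast (hn : 1 ≤ n) (k : Fin (m / n)) : Fin m :=
  blockIdx n m (k, ⟨n - 1, by omega⟩)

theorem blockLast_val (hn : 1 ≤ n) (k : Fin (m / n)) :
    (blockLast hn k).val = n - 1 + n * k.val := by
  simp [blockLast, blockIdx_val]

theorem RRS_eq_sum (hn : 1 ≤ n) (I : PubInst n m) (i : Fin n) :
    I.RRS i = ∑ k : Fin (m / n), sortedDesc (I.umax i) (blockLast hn k) := by
  refine sum_ite_eq_sum_of_range _ _ _ ?_ ?_
  · intro a b hab
    have := blockIdx_injective hab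
    simpa using this
  · intro r
    constructor
    · rintro ⟨⟨q, hq⟩, hle⟩
      have hq0 : 1 ≤ q := by
        rcases Nat.eq_zero_or_pos q with rfl | h
        · simp at hq
        · exact h
      have hqp : q ≤ m / n := by
        rw [hq, mul_comm] at hle
        exact Nat.le_of_mul_le_mul_right hle hn
      refine ⟨⟨q - 1, by omega⟩, Fin.ext ?_⟩
      rw [blockLast_val]
      obtain ⟨q, rfl⟩ := Nat.exists_eq_add_of_le' hq0
      simp only [Nat.add_sub_cancel]
      rw [Nat.mul_add] at hq
      omega
    · rintro ⟨k, rfl⟩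
      have h1 : (blockLast hn k).val + 1 = n * (k.val + 1) := by
        rw [blockLast_val, Nat.mul_add]
        omega
      rw [h1]
      exact ⟨⟨_, rfl⟩, (mul_comm n _).trans_le (Nat.mul_le_mul_right n k.isLt)⟩

theorem PPS_le_RRS (hn : 1 ≤ n) (I : PubInst n m) (i : Fin n) : I.PPS i ≤ I.RRS i := by
  have hpm : m / n ≤ m := Nat.div_le_self m n
  have hP : I.PPS i = ∑ k : Fin (m / n), sortedDesc (I.umax i)
      ⟨m - m / n + k.val, by have := k.isLt; omega⟩ := by
    refine sum_ite_eq_sum_of_range _ _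
      (fun k : Fin (m / n) => (⟨m - m / n + k.val, by have := k.isLt; omega⟩ : Fin m)) ?_ ?_
    · intro a b hab
      simp only [Fin.mk.injEq] at hab
      exact Fin.ext (by omega)
    · intro r
      constructor
      · intro h
        have := r.isLt
        exact ⟨⟨r.val - (m - m / n), by omega⟩, Fin.ext (by simp only; omega)⟩
      · rintro ⟨k, rfl⟩
        simp
  rw [hP, RRS_eq_sum hn]
  refine Finset.sum_le_sum fun k _ => sortedDesc_antitone _ ?_
  rw [Fin.le_def, blockLast_val]
  have hk := k.isLt
  have h1 : m / n * n ≤ m := Nat.div_mul_le_self m n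
  obtain ⟨d, rfl⟩ := Nat.exists_eq_add_of_le' hn
  have h2 : d * (k.val + 1) ≤ d * (m / (d + 1)) := Nat.mul_le_mul_left d hk
  simp only [Nat.add_sub_cancel]
  have h3 : m / (d + 1) * (d + 1) = d * (m / (d + 1)) + m / (d + 1) := by ring
  have h4 : d + (d + 1) * k.val = d * (k.val + 1) + k.val := by ring
  omega

/-- The outcome that takes an alternative from `b` on the issues of `T` and follows `c` elsewhere. -/
def switch (I : PubInst n m) (c b : I.Outcome) (T : Finset (Fin m)) : I.Outcome :=
  fun t => if t ∈ T then b t else c t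

theorem sum_le_util_switch (I : PubInst n m) (c b : I.Outcome) (T : Finset (Fin m)) (j : Fin n) :
    ∑ t ∈ T, I.u j t (b t) ≤ I.util (I.switch c b T) j := by
  calc ∑ t ∈ T, I.u j t (b t) = ∑ t ∈ T, I.u j t (I.switch c b T t) :=
        Finset.sum_congr rfl fun t ht => by simp [switch, ht]
    _ ≤ _ := Finset.sum_le_sum_of_subset_of_nonneg (subset_univ T) fun t _ _ => I.nonneg _ _ _

theorem util_sub_le_util_switch (I : PubInst n m) (c b : I.Outcome) (T : Finset (Fin m))
    (j : Fin n) :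
    I.util c j - ∑ t ∈ T, I.u j t (c t) ≤ I.util (I.switch c b T) j := by
  have h : I.util c j - ∑ t ∈ T, I.u j t (c t) = ∑ t ∈ Tᶜ, I.u j t (c t) := by
    rw [util, ← Finset.sum_add_sum_compl T]
    ring
  rw [h]
  calc ∑ t ∈ Tᶜ, I.u j t (c t) = ∑ t ∈ Tᶜ, I.u j t (I.switch c b T t) :=
        Finset.sum_congr rfl fun t ht => by simp [switch, Finset.mem_compl.mp ht]
    _ ≤ _ := Finset.sum_le_sum_of_subset_of_nonneg (subset_univ _) fun t _ _ => I.nonneg _ _ _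

theorem one_sub_sum_le_prod {ι : Type*} (s : Finset ι) (x : ι → ℝ) (h0 : ∀ j ∈ s, 0 ≤ x j)
    (h1 : ∀ j ∈ s, x j ≤ 1) : 1 - ∑ j ∈ s, x j ≤ ∏ j ∈ s, (1 - x j) := by
  classical
  induction s using Finset.induction_on with
  | empty => simp
  | insert a s ha ih =>
    rw [Finset.sum_insert ha, Finset.prod_insert ha]
    have ih' := ih (fun j hj => h0 j (mem_insert_of_mem hj)) (fun j hj => h1 j (mem_insert_of_mem hj))
    have ha0 := h0 a (mem_insert_self a s)
    have ha1 := h1 a (mem_insert_self a s)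
    have hs : 0 ≤ ∑ j ∈ s, x j := Finset.sum_nonneg fun j hj => h0 j (mem_insert_of_mem hj)
    nlinarith [mul_le_mul_of_nonneg_left ih' (sub_nonneg.mpr ha1), mul_nonneg ha0 hs]

/-- One issue can be picked from each block so that the picked issues carry at most a `1 / n`
fraction of a nonnegative total weight. -/
theorem exists_block_choice (hn : 1 ≤ n) (σ : Equiv.Perm (Fin m)) (L : Fin m → ℝ)
    (hL : ∀ t, 0 ≤ L t) :
    ∃ l : Fin (m / n) → Fin n,
      n * ∑ k, L (σ (blockIdx n m (k, l k))) ≤ ∑ t, L t := by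
  have : Nonempty (Fin n) := ⟨⟨0, hn⟩⟩
  have h : ∀ k : Fin (m / n), ∃ l : Fin n,
      ∀ l', L (σ (blockIdx n m (k, l))) ≤ L (σ (blockIdx n m (k, l'))) :=
    fun k => Finite.exists_min _
  choose l hl using h
  refine ⟨l, ?_⟩
  calc n * ∑ k, L (σ (blockIdx n m (k, l k)))
      = ∑ k, ∑ _l' : Fin n, L (σ (blockIdx n m (k, l k))) := by
        rw [Finset.mul_sum]
        simp
    _ ≤ ∑ k, ∑ l' : Fin n, L (σ (blockIdx n m (k, l'))) :=
        Finset.sum_le_sum fun k _ => Finset.sum_le_sum fun l' _ => hl k l'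
    _ = ∑ x : Fin (m / n) × Fin n, L (σ (blockIdx n m x)) := by
        rw [Fintype.sum_prod_type]
    _ = ∑ t ∈ univ.image (fun x => σ (blockIdx n m x)), L t :=
        (Finset.sum_image (σ.injective.comp blockIdx_injective).injOn).symm
    _ ≤ ∑ t, L t := Finset.sum_le_sum_of_subset_of_nonneg (subset_univ _) fun t _ _ => hL t

theorem util_pos_of_RRS_pos (hn : 1 ≤ n) (I : PubInst n m) (c : I.Outcome) (hc : I.MNW c)
    (i : Fin n) (hR : 0 < I.RRS i) : 0 < I.util c i := by
  classical
  by_contra hi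
  set S := univ.filter fun i => 0 < I.util c i with hS
  have hiS : i ∉ S := by simpa [hS] using hi
  have hex : ∀ j, ∃ t, 0 < I.util c j → 0 < I.u j t (c t) := by
    intro j
    by_cases hj : 0 < I.util c j
    · obtain ⟨t, -, ht⟩ := Finset.exists_lt_of_sum_lt
        (s := univ) (f := fun _ => (0 : ℝ)) (g := fun t => I.u j t (c t)) (by simpa [util] using hj)
      exact ⟨t, fun _ => ht⟩
    · rw [RRS_eq_sum hn] at hR
      obtain ⟨k, -, -⟩ := Finset.exists_ne_zero_of_sum_ne_zero hR.ne'
      exact ⟨blockLast hn k, fun h => absurd h hj⟩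
  choose p hp using hex
  rw [RRS_eq_sum hn] at hR
  obtain ⟨k, -, hk⟩ := Finset.exists_lt_of_sum_lt
    (s := univ) (f := fun _ => (0 : ℝ))
    (g := fun k : Fin (m / n) => sortedDesc (I.umax i) (blockLast hn k)) (by simpa using hR)
  let σ := Tuple.sort fun j => -I.umax i j
  let q : Fin n → Fin m := fun l => σ (blockIdx n m (k, l))
  have hq : Function.Injective q := by
    intro a b hab
    have := blockIdx_injective (σ.injective hab)
    simpa using this
  have hqpos : ∀ l, 0 < I.umax i (q l) := by
    intro l
    refine lt_of_lt_of_le hk (sortedDesc_antitone (I.umax i) ?_)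
    rw [Fin.le_def, blockLast_val, blockIdx_val]
    have := l.isLt
    simp only
    omega
  have hcard : (S.image p).card < (univ.image q).card := by
    rw [Finset.card_image_of_injective _ hq, Finset.card_fin]
    refine Finset.card_image_le.trans_lt ?_
    simpa using Finset.card_lt_univ_of_notMem hiS
  obtain ⟨t, htq, htp⟩ := Finset.exists_mem_notMem_of_card_lt_card hcard
  obtain ⟨l, -, rfl⟩ := Finset.mem_image.mp htq
  choose b hb using I.exists_eq_umax i
  let c' := I.switch c b {q l}
  have hi' : 0 < I.util c' i := by
    refine lt_of_lt_of_le ?_ (I.sum_le_util_switch c b {q l} i)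
    simpa [hb] using hqpos l
  have hsub : insert i S ⊆ univ.filter fun i => 0 < I.util c' i := by
    intro j hj
    rw [Finset.mem_filter]
    refine ⟨mem_univ _, ?_⟩
    rcases Finset.mem_insert.mp hj with rfl | hjS
    · exact hi'
    · have hne : p j ≠ q l := fun h => htp (Finset.mem_image.mpr ⟨j, hjS, h⟩)
      have hpos := hp j (Finset.mem_filter.mp hjS).2
      refine lt_of_lt_of_le ?_ (Finset.single_le_sum (fun t _ => I.nonneg j t (c' t))
        (mem_univ (p j)))
      simpa [c', switch, hne] using hpos
  have h1 := Finset.card_le_card hsub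
  have h2 : _ ≤ S.card := hc.1 c'
  rw [Finset.card_insert_of_notMem hiS] at h1
  omega

theorem RRS_le_mul_util (hn : 1 ≤ n) (I : PubInst n m) (c : I.Outcome) (hc : I.MNW c)
    (i : Fin n) : I.RRS i ≤ n * I.util c i := by
  classical
  by_contra! hlt
  have hn0 : (0 : ℝ) < n := by exact_mod_cast hn
  have hR : 0 < I.RRS i := lt_of_le_of_lt (mul_nonneg hn0.le (I.util_nonneg c i)) hlt
  have hi := I.util_pos_of_RRS_pos hn c hc i hR
  have hprod := hc.2
  set S := univ.filter fun i => 0 < I.util c i with hS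
  have hiS : i ∈ S := by simpa [hS] using hi
  have hpos : ∀ j ∈ S, 0 < I.util c j := fun j hj => (Finset.mem_filter.mp hj).2
  let L : Fin m → ℝ := fun t => ∑ j ∈ S.erase i, I.u j t (c t) / I.util c j
  have hterm : ∀ j ∈ S.erase i, ∀ t, 0 ≤ I.u j t (c t) / I.util c j := fun j hj t =>
    div_nonneg (I.nonneg _ _ _) (I.util_nonneg c j)
  have hLsum : ∑ t, L t ≤ n - 1 := by
    have h1 : ∑ t, L t = ((S.erase i).card : ℝ) := by
      rw [Finset.sum_comm, Finset.card_eq_sum_ones, Nat.cast_sum]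
      refine Finset.sum_congr rfl fun j hj => ?_
      rw [← Finset.sum_div, Nat.cast_one]
      exact div_self (hpos j (Finset.mem_of_mem_erase hj)).ne'
    have h2 : (S.erase i).card + 1 ≤ n := by
      rw [Finset.card_erase_add_one hiS]
      simpa using Finset.card_le_univ S
    have h3 : ((S.erase i).card : ℝ) + 1 ≤ n := by exact_mod_cast h2
    linarith
  let σ := Tuple.sort fun j => -I.umax i j
  obtain ⟨l, hl⟩ := exists_block_choice hn σ L fun t => Finset.sum_nonneg fun j hj => hterm j hj t
  let q : Fin (m / n) → Fin m := fun k => σ (blockIdx n m (k, l k))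
  have hq : Function.Injective q := by
    intro a b hab
    exact congrArg Prod.fst (blockIdx_injective (σ.injective hab))
  let T := univ.image q
  choose b hb using I.exists_eq_umax i
  let c' := I.switch c b T
  have hui : I.RRS i ≤ I.util c' i := by
    refine le_trans ?_ (I.sum_le_util_switch c b T i)
    rw [RRS_eq_sum hn, Finset.sum_image hq.injOn]
    refine Finset.sum_le_sum fun k _ => ?_
    rw [hb]
    refine sortedDesc_antitone (I.umax i) (?_ : blockIdx n m (k, l k) ≤ _)
    rw [Fin.le_def, blockLast_val, blockIdx_val]
    have := (l k).isLt
    simp only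
    omega
  let x : Fin n → ℝ := fun j => (∑ t ∈ T, I.u j t (c t)) / I.util c j
  have hx0 : ∀ j ∈ S.erase i, 0 ≤ x j := fun j _ =>
    div_nonneg (Finset.sum_nonneg fun t _ => I.nonneg _ _ _) (I.util_nonneg c j)
  have hx1 : ∀ j ∈ S.erase i, x j ≤ 1 := fun j _ =>
    div_le_one_of_le₀ (Finset.sum_le_sum_of_subset_of_nonneg (subset_univ _)
      fun t _ _ => I.nonneg _ _ _) (I.util_nonneg c j)
  have hxsum : n * ∑ j ∈ S.erase i, x j ≤ n - 1 := by
    have : ∑ j ∈ S.erase i, x j = ∑ k, L (q k) := by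
      simp only [x, L, Finset.sum_div]
      rw [Finset.sum_comm, Finset.sum_image hq.injOn]
    rw [this]
    exact hl.trans hLsum
  have hxprod := one_sub_sum_le_prod (S.erase i) x hx0 hx1
  have hP : 0 < ∏ j ∈ S.erase i, I.util c j :=
    Finset.prod_pos fun j hj => hpos j (Finset.mem_of_mem_erase hj)
  have hothers : (∏ j ∈ S.erase i, I.util c j) * ∏ j ∈ S.erase i, (1 - x j) ≤
      ∏ j ∈ S.erase i, I.util c' j := by
    rw [← Finset.prod_mul_distrib]
    refine Finset.prod_le_prod (fun j hj => mul_nonneg (I.util_nonneg c j)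
      (sub_nonneg.mpr (hx1 j hj))) fun j hj => ?_
    refine le_trans (le_of_eq ?_) (I.util_sub_le_util_switch c b T j)
    rw [mul_sub, mul_one, mul_div_cancel₀ _ (hpos j (Finset.mem_of_mem_erase hj)).ne']
  have hmax := hprod c'
  rw [← Finset.mul_prod_erase S _ hiS, ← Finset.mul_prod_erase S _ hiS] at hmax
  set P := ∏ j ∈ S.erase i, I.util c j
  set Q := ∏ j ∈ S.erase i, (1 - x j)
  have hQ : 1 ≤ n * Q := by nlinarith [mul_le_mul_of_nonneg_left hxprod hn0.le]
  have hQ0 : 0 ≤ Q := Finset.prod_nonneg fun j hj => sub_nonneg.mpr (hx1 j hj)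
  have hQpos : 0 < Q := by
    rcases hQ0.eq_or_lt with h | h
    · rw [← h] at hQ
      norm_num at hQ
    · exact h
  have h1 : I.RRS i * (P * Q) ≤ I.util c i * P :=
    (mul_le_mul hui hothers (mul_pos hP hQpos).le (I.util_nonneg c' i)).trans hmax
  have h2 : I.RRS i * Q ≤ I.util c i := by
    refine le_of_mul_le_mul_right ?_ hP
    rwa [mul_assoc, mul_comm Q P]
  have h3 := mul_lt_mul_of_pos_right hlt hQpos
  have h4 := mul_le_mul_of_nonneg_left hQ hi.le
  nlinarith

end PubInst

/-- In any public decision making instance, every maximum Nash welfare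
outcome satisfies `(1/n)`-RRS, and consequently also `(1/n)`-PPS. -/
theorem MNW_one_over_n_RRS_PPS {n m : ℕ} (hn : 1 ≤ n) (I : PubInst n m) (c : I.Outcome)
    (hMNW : I.MNW c) :
    (∀ i : Fin n, (1 / (n : ℝ)) * I.RRS i ≤ I.util c i) ∧
    (∀ i : Fin n, (1 / (n : ℝ)) * I.PPS i ≤ I.util c i) := by
  have hn0 : (0 : ℝ) < n := by exact_mod_cast hn
  have hRRS : ∀ i : Fin n, (1 / (n : ℝ)) * I.RRS i ≤ I.util c i := fun i => by
    rw [one_div, inv_mul_le_iff₀ hn0]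
    exact I.RRS_le_mul_util hn c hMNW i
  exact ⟨hRRS, fun i => (mul_le_mul_of_nonneg_left (I.PPS_le_RRS hn i)
    (one_div_nonneg.mpr hn0.le)).trans (hRRS i)⟩
end

section
/- For every ε > 0 there exists a private goods division instance with 2 players and 4 goods, and a maximum Nash welfare (MNW) allocation A, such that u_1(A_1) < (2/3 + ε)·RRS_1. Explicitly, for sufficiently small δ > 0, let player 1 have utilities (1−δ, 1−δ, 1/2, 1/2) and player 2 have utilities (1, 1, 0, 0) for goods (g_1, g_2, g_3, g_4); then A_1 = {g_3, g_4}, A_2 = {g_1, g_2} is an MNW allocation, RRS_1 = 3/2 − δ, and u_1(A_1)/RRS_1 = 2/(3 − 2δ). Consequently, for private goods the MNW solution does not satisfy (2/3 + ε)-RRS for any ε > 0. -/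
open Finset

-- A private goods division instance with `n` players and `m` goods: the goods are
-- `Fin m`, player `i` values good `g` at `u i g`, and an allocation is a function
-- `A : Fin m → Fin n` assigning each good to a player (a partition of the goods).

/-- Value of player `i` for the bundle allocated to player `j` under allocation `A`. -/
noncomputable def bundleVal {n m : ℕ} (u : Fin n → Fin m → ℝ) (A : Fin m → Fin n)
    (i j : Fin n) : ℝ :=
  ∑ g : Fin m, if A g = j then u i g else 0

/-- Envy-freeness up to one good: every player `i` either does not envy `j`, or does not
envy `j` after removing some single good from `j`'s bundle. -/
def EF1 {n m : ℕ} (u : Fin n → Fin m → ℝ) (A : Fin m → Fin n) : Prop :=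
  ∀ i j : Fin n,
    bundleVal u A i j ≤ bundleVal u A i i ∨
    ∃ g0 : Fin m, A g0 = j ∧
      (∑ g : Fin m, if A g = j ∧ g ≠ g0 then u i g else 0) ≤ bundleVal u A i i

/-- The proportional share of player `i`: a `1/n` fraction of her value for all goods. -/
noncomputable def propShare {n m : ℕ} (u : Fin n → Fin m → ℝ) (i : Fin n) : ℝ :=
  (∑ g : Fin m, u i g) / (n : ℝ)

/-- Values of `f` sorted in non-increasing order: `sortedDesc f r` is the `(r+1)`-th largest. -/
noncomputable def sortedDesc {m : ℕ} (f : Fin m → ℝ) : Fin m → ℝ :=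
  fun r => f (Tuple.sort (fun j => -f j) r)

/-- The round robin share of player `i`: the sum of her `(k·n)`-th largest values for
`k = 1, …, ⌊m/n⌋` (ranks are 1-indexed; rank `r+1` corresponds to index `r : Fin m`). -/
noncomputable def RRSshare {n m : ℕ} (u : Fin n → Fin m → ℝ) (i : Fin n) : ℝ :=
  ∑ r : Fin m,
    if n ∣ (r.val + 1) ∧ r.val + 1 ≤ (m / n) * n then sortedDesc (u i) r else 0

/-- The pessimistic proportional share of player `i`: the sum of her `⌊m/n⌋` smallest
values among all goods. -/
noncomputable def PPSshare {n m : ℕ} (u : Fin n → Fin m → ℝ) (i : Fin n) : ℝ :=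
  ∑ r : Fin m, if m - m / n ≤ r.val then sortedDesc (u i) r else 0

/-- Pareto optimality of an allocation. -/
def ParetoOptimalAlloc {n m : ℕ} (u : Fin n → Fin m → ℝ) (A : Fin m → Fin n) : Prop :=
  ¬ ∃ A' : Fin m → Fin n,
      (∀ i, bundleVal u A i i ≤ bundleVal u A' i i) ∧
      ∃ j, bundleVal u A j j < bundleVal u A' j j

/-- Maximum Nash welfare allocation: with `S` the set of players getting positive utility,
`S` has maximum possible cardinality, and the allocation maximizes the product of the
utilities of players in `S`. -/
def MNWalloc {n m : ℕ} (u : Fin n → Fin m → ℝ) (A : Fin m → Fin n) : Prop :=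
  (∀ A' : Fin m → Fin n,
      (Finset.univ.filter fun i => 0 < bundleVal u A' i i).card ≤
        (Finset.univ.filter fun i => 0 < bundleVal u A i i).card) ∧
  (∀ A' : Fin m → Fin n,
      (∏ i ∈ Finset.univ.filter fun i => 0 < bundleVal u A i i, bundleVal u A' i i) ≤
        ∏ i ∈ Finset.univ.filter fun i => 0 < bundleVal u A i i, bundleVal u A i i)

/-- Proportionality up to one good. -/
def Prop1alloc {n m : ℕ} (u : Fin n → Fin m → ℝ) (A : Fin m → Fin n) : Prop :=
  ∀ i : Fin n,
    propShare u i ≤ bundleVal u A i i ∨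
    ∃ g : Fin m, A g ≠ i ∧ propShare u i ≤ bundleVal u A i i + u i g

theorem sortedDesc_eq_self_of_antitone {m : ℕ} {f : Fin m → ℝ} (hf : Antitone f) :
    sortedDesc f = f := by
  have hsort : Tuple.sort (fun j => -f j) = Equiv.refl _ :=
    Tuple.sort_eq_refl_iff_monotone.2 fun _ _ hab => neg_le_neg (hf hab)
  funext r
  simp [sortedDesc, hsort]

/-- An allocation giving every player positive utility is an MNW allocation as soon as it
maximizes the product of all utilities. -/
theorem MNWalloc_of_pos_of_prod_le {n m : ℕ} {u : Fin n → Fin m → ℝ} {A : Fin m → Fin n}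
    (hpos : ∀ i, 0 < bundleVal u A i i)
    (hprod : ∀ A' : Fin m → Fin n, ∏ i, bundleVal u A' i i ≤ ∏ i, bundleVal u A i i) :
    MNWalloc u A := by
  have huniv : (Finset.univ.filter fun i => 0 < bundleVal u A i i) = Finset.univ :=
    Finset.filter_true_of_mem fun i _ => hpos i
  refine ⟨fun A' => ?_, fun A' => ?_⟩
  · rw [huniv]
    exact Finset.card_le_card (Finset.filter_subset _ _)
  · rw [huniv]
    exact hprod A'

/-- For every `ε > 0` there is a private goods division instance with 2
players and 4 goods, and a maximum Nash welfare allocation `A`, under which player 1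
(index `0`) receives strictly less than a `(2/3 + ε)` fraction of her round robin share.
Hence, for private goods, the MNW solution does not satisfy `(2/3 + ε)`-RRS for any
`ε > 0`. -/
theorem MNW_not_two_thirds_RRS (ε : ℝ) (hε : 0 < ε) :
    ∃ (u : Fin 2 → Fin 4 → ℝ) (A : Fin 4 → Fin 2),
      (∀ i g, 0 ≤ u i g) ∧ MNWalloc u A ∧ 0 < RRSshare u 0 ∧
      bundleVal u A 0 0 < (2 / 3 + ε) * RRSshare u 0 := by
  have hanti : Antitone (![1, 1, 1 / 2, 1 / 2] : Fin 4 → ℝ) := by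
    intro a b hab
    fin_cases a <;> fin_cases b <;> first | (norm_num; done) | simp at hab
  have hshare : RRSshare ![![1, 1, 1 / 2, 1 / 2], ![1, 1, 0, 0]] 0 = 3 / 2 := by
    simp only [RRSshare, Matrix.cons_val_zero, sortedDesc_eq_self_of_antitone hanti]
    simp [Fin.sum_univ_four]
    norm_num
  have h₀ : bundleVal ![![1, 1, 1 / 2, 1 / 2], ![1, 1, 0, 0]] ![1, 1, 0, 0] 0 0 = 1 := by
    simp [bundleVal, Fin.sum_univ_four]
    norm_num
  have h₁ : bundleVal ![![1, 1, 1 / 2, 1 / 2], ![1, 1, 0, 0]] ![1, 1, 0, 0] 1 1 = 2 := by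
    simp [bundleVal, Fin.sum_univ_four]
    norm_num
  refine ⟨![![1, 1, 1 / 2, 1 / 2], ![1, 1, 0, 0]], ![1, 1, 0, 0], ?_, ?_, ?_, ?_⟩
  · intro i g
    fin_cases i <;> fin_cases g <;> norm_num
  · apply MNWalloc_of_pos_of_prod_le
    · intro i
      fin_cases i
      · exact one_pos.trans_eq h₀.symm
      · exact two_pos.trans_eq h₁.symm
    · intro A'
      rw [Fin.prod_univ_two, Fin.prod_univ_two, h₀, h₁]
      have hcases (i : Fin 2) : i = 0 ∨ i = 1 := by omega
      rcases hcases (A' 0) with ha | ha <;> rcases hcases (A' 1) with hb | hb <;>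
        rcases hcases (A' 2) with hc | hc <;> rcases hcases (A' 3) with hd | hd <;>
        simp [bundleVal, Fin.sum_univ_four, ha, hb, hc, hd] <;> norm_num
  · rw [hshare]
    norm_num
  · rw [hshare, h₀]
    linarith
end
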